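/- arXiv:1210.0990 — 7 statements merged into one kernel-verified Lean document; each statement's English description precedes it below -/
import Mathlib

section
/- Let k be a field, V a k-vector space, and R a finite-rank endomorphism of V. Then rank R ≤ 1 if and only if for every finite-rank endomorphism A of V there exists a scalar c ∈ k such that (A ∘ R) ∘ (A ∘ R) = c • (A ∘ R). -/
/-- A finite linearly independent family can be sent to any prescribed family by a
finite-rank linear map. -/
theorem LinearIndependent.exists_finiteRank_map_eq {ι k V W : Type*} [Finite ι] [Field k]
    [AddCommGroup V] [Module k V] [AddCommGroup W] [Module k W] {v : ι → V}
    (hv : LinearIndependent k v) (w : ι → W) :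
    ∃ A : V →ₗ[k] W, FiniteDimensional k (LinearMap.range A) ∧ ∀ i, A (v i) = w i := by
  obtain ⟨g, hg⟩ := (Finsupp.linearCombination k v).exists_leftInverse_of_injective
    (LinearMap.ker_eq_bot.2 hv)
  refine ⟨Finsupp.linearCombination k w ∘ₗ g, ?_, fun i ↦ ?_⟩
  · exact Submodule.finiteDimensional_of_le (LinearMap.range_comp_le_range g _)
  · have hgi : g (v i) = Finsupp.single i 1 := by
      simpa using LinearMap.congr_fun hg (Finsupp.single i 1)
    simp [hgi]

/-- Eidelheit's algebraic characterization of rank-one elements: for a finite-rank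
endomorphism `R` of a vector space `V` over a field `k`, `rank R ≤ 1` holds if and only if
for every finite-rank endomorphism `A` there is a scalar `c` with
`(A ∘ R) ∘ (A ∘ R) = c • (A ∘ R)`. -/
theorem rank_le_one_iff_comp_sq_smul {k V : Type*} [Field k] [AddCommGroup V] [Module k V]
    (R : Module.End k V) (hR : FiniteDimensional k (LinearMap.range R)) :
    Module.finrank k (LinearMap.range R) ≤ 1 ↔
      ∀ A : Module.End k V, FiniteDimensional k (LinearMap.range A) →
        ∃ c : k, (A ∘ₗ R) ∘ₗ (A ∘ₗ R) = c • (A ∘ₗ R) := by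
  constructor
  · intro h A _
    obtain ⟨w, hw⟩ := finrank_le_one_iff.1 h
    have hspan (x : V) : ∃ a : k, a • (w : V) = R x := by
      obtain ⟨a, ha⟩ := hw ⟨R x, x, rfl⟩
      exact ⟨a, congrArg Subtype.val ha⟩
    obtain ⟨c, hc⟩ := hspan (A w)
    refine ⟨c, LinearMap.ext fun x ↦ ?_⟩
    obtain ⟨a, ha⟩ := hspan x
    simp [← ha, ← hc, smul_comm a c]
  · intro h
    by_contra! hlt
    obtain ⟨u, hu⟩ := exists_linearIndependent_of_le_finrank (R := k) (Nat.succ_le_of_lt hlt)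
    choose x hx using fun i ↦ (u i).2
    have hli : LinearIndependent k (fun i ↦ (u i : V)) :=
      hu.map' (LinearMap.range R).subtype (Submodule.ker_subtype _)
    have hx_ne : x 0 ≠ 0 := fun h0 ↦ hli.ne_zero 0 (by rw [← hx, h0, map_zero])
    -- On the span of `x 0, x 1`, the map `A ∘ R` is a nontrivial unipotent Jordan block.
    obtain ⟨A, hA, hAu⟩ := hli.exists_finiteRank_map_eq ![x 0, x 0 + x 1]
    have h0 : A (R (x 0)) = x 0 := by simpa [hx] using hAu 0
    have h1 : A (R (x 1)) = x 0 + x 1 := by simpa [hx] using hAu 1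
    obtain ⟨c, hc⟩ := h A hA
    have hc0 : x 0 = c • x 0 := by simpa [h0] using LinearMap.congr_fun hc (x 0)
    have hc1 : x 0 + (x 0 + x 1) = c • (x 0 + x 1) := by
      simpa [h0, h1] using LinearMap.congr_fun hc (x 1)
    obtain rfl : c = 1 := smul_left_injective k hx_ne (by simpa using hc0.symm)
    exact hx_ne (by simpa using hc1)
end

section
/- Let k be a field and V₁, V₂ k-vector spaces. Let Φ : F(V₁) → F(V₂) be a bijective k-linear map between the algebras of finite-rank endomorphisms satisfying Φ(A ∘ B) = Φ(A) ∘ Φ(B) for all A, B ∈ F(V₁). If R ∈ F(V₁) has rank exactly 1, then Φ(R) has rank exactly 1. -/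
/-- The non-unital subalgebra of finite-rank endomorphisms of `V`. -/
def finRankOps (k V : Type*) [Field k] [AddCommGroup V] [Module k V] :
    NonUnitalSubalgebra k (Module.End k V) where
  carrier := {A : Module.End k V | FiniteDimensional k (LinearMap.range A)}
  add_mem' := by
    intro a b ha hb
    have hle : LinearMap.range (a + b) ≤ LinearMap.range a ⊔ LinearMap.range b := by
      rintro _ ⟨x, rfl⟩
      exact Submodule.add_mem_sup (LinearMap.mem_range_self a x) (LinearMap.mem_range_self b x)
    haveI : FiniteDimensional k (LinearMap.range a) := ha
    haveI : FiniteDimensional k (LinearMap.range b) := hb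
    exact Submodule.finiteDimensional_of_le hle
  zero_mem' := by
    have h : LinearMap.range (0 : Module.End k V) = ⊥ := LinearMap.range_zero
    show FiniteDimensional k (LinearMap.range (0 : Module.End k V))
    rw [h]
    infer_instance
  mul_mem' := by
    intro a b ha hb
    haveI : FiniteDimensional k (LinearMap.range a) := ha
    have hle : LinearMap.range (a * b) ≤ LinearMap.range a := by
      rintro _ ⟨x, rfl⟩
      exact LinearMap.mem_range_self a (b x)
    exact Submodule.finiteDimensional_of_le hle
  smul_mem' := by
    intro c a ha
    haveI : FiniteDimensional k (LinearMap.range a) := ha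
    have hle : LinearMap.range (c • a) ≤ LinearMap.range a := by
      rintro _ ⟨x, rfl⟩
      exact Submodule.smul_mem _ c (LinearMap.mem_range_self a x)
    exact Submodule.finiteDimensional_of_le hle

/-- If `S` has rank one then `S A S` is a scalar multiple of `S` for every `A`. -/
theorem exists_mul_mul_eq_smul_of_finrank_range_eq_one {k V : Type*} [Field k]
    [AddCommGroup V] [Module k V] {S : Module.End k V}
    (hS : Module.finrank k (LinearMap.range S) = 1) (A : Module.End k V) :
    ∃ c : k, S * A * S = c • S := by
  obtain ⟨⟨w, hw⟩, -, hspan⟩ := finrank_eq_one_iff'.mp hS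
  have hmem : ∀ x, ∃ c : k, c • w = S x := fun x => by
    obtain ⟨c, hc⟩ := hspan ⟨S x, LinearMap.mem_range_self S x⟩
    exact ⟨c, congrArg Subtype.val hc⟩
  obtain ⟨c, hc⟩ := hmem (A w)
  refine ⟨c, LinearMap.ext fun x => ?_⟩
  obtain ⟨d, hd⟩ := hmem x
  rw [Module.End.mul_apply, Module.End.mul_apply, LinearMap.smul_apply, ← hd, map_smul,
    map_smul, ← hc, smul_comm]

theorem smulRight_mem_finRankOps {k V : Type*} [Field k] [AddCommGroup V] [Module k V]
    (f : V →ₗ[k] k) (v : V) : f.smulRight v ∈ finRankOps k V := by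
  have hle : LinearMap.range (f.smulRight v) ≤ Submodule.span k {v} := by
    rintro _ ⟨x, rfl⟩
    exact Submodule.mem_span_singleton.mpr ⟨f x, rfl⟩
  exact Submodule.finiteDimensional_of_le hle

/-- A nonzero `S` such that `S A S` is a scalar multiple of `S` for every finite-rank `A`
has rank one. -/
theorem finrank_range_eq_one_of_mul_mul_eq_smul {k V : Type*} [Field k]
    [AddCommGroup V] [Module k V] {S : Module.End k V} (hS : S ≠ 0)
    (h : ∀ A ∈ finRankOps k V, ∃ c : k, S * A * S = c • S) :
    Module.finrank k (LinearMap.range S) = 1 := by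
  obtain ⟨v, hv⟩ : ∃ v, S v ≠ 0 := by
    by_contra! h0
    exact hS (LinearMap.ext h0)
  obtain ⟨f, hf⟩ := Module.Projective.exists_dual_ne_zero k hv
  refine finrank_eq_one_iff'.mpr ⟨⟨S v, LinearMap.mem_range_self S v⟩, ?_, ?_⟩
  · exact fun h0 => hv (congrArg Subtype.val h0)
  · rintro ⟨_, x, rfl⟩
    obtain ⟨c, hc⟩ := h _ (smulRight_mem_finRankOps f x)
    have hx : f (S v) • S x = c • S v := by
      simpa using LinearMap.congr_fun hc v
    refine ⟨(f (S v))⁻¹ * c, Subtype.ext ?_⟩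
    change ((f (S v))⁻¹ * c) • S v = S x
    rw [mul_smul, ← hx, inv_smul_smul₀ hf]

/-- An algebra isomorphism between the algebras of finite-rank endomorphisms maps
rank-one operators to rank-one operators. -/
theorem rank_one_of_rank_one_of_mulEquiv {k V₁ V₂ : Type*} [Field k]
    [AddCommGroup V₁] [Module k V₁] [AddCommGroup V₂] [Module k V₂]
    (Φ : finRankOps k V₁ →ₗ[k] finRankOps k V₂) (hΦ : Function.Bijective Φ)
    (hmul : ∀ A B : finRankOps k V₁, Φ (A * B) = Φ A * Φ B)
    (R : finRankOps k V₁)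
    (hR : Module.finrank k (LinearMap.range (R : Module.End k V₁)) = 1) :
    Module.finrank k (LinearMap.range ((Φ R : Module.End k V₂))) = 1 := by
  refine finrank_range_eq_one_of_mul_mul_eq_smul ?_ ?_
  · intro h0
    have hR0 : R = 0 := hΦ.injective ((Subtype.ext h0 : Φ R = 0).trans (map_zero Φ).symm)
    rw [hR0, ZeroMemClass.coe_zero, LinearMap.range_zero, finrank_bot] at hR
    exact zero_ne_one hR
  · intro B hB
    obtain ⟨A, hA⟩ := hΦ.surjective ⟨B, hB⟩
    obtain ⟨c, hc⟩ := exists_mul_mul_eq_smul_of_finrank_range_eq_one hR (A : Module.End k V₁)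
    have hRAR : R * A * R = c • R := Subtype.ext hc
    have hΦRAR : Φ R * ⟨B, hB⟩ * Φ R = c • Φ R := by
      rw [← hA, ← hmul, ← hmul, hRAR, map_smul]
    exact ⟨c, congrArg Subtype.val hΦRAR⟩
end

section
/- Let k be a field and V a nonzero k-vector space. Let D : F(V) → End_k(V) be a k-linear map satisfying the Leibniz rule D(A ∘ B) = D(A) ∘ B + A ∘ D(B) for all finite-rank endomorphisms A, B of V. Then there exists a linear endomorphism L of V such that D(A) = L ∘ A − A ∘ L for every finite-rank endomorphism A of V. -/
/-- The rank-one operator `x ↦ φ x • v`, linear in `v`, as an element of `finRankOps k V`. -/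
def rankOneOp {k V : Type*} [Field k] [AddCommGroup V] [Module k V] (φ : Module.Dual k V) :
    V →ₗ[k] finRankOps k V where
  toFun v := ⟨φ.smulRight v, by
    have hle : LinearMap.range (φ.smulRight v) ≤ Submodule.span k {v} := by
      rintro _ ⟨x, rfl⟩
      exact Submodule.smul_mem _ _ (Submodule.mem_span_singleton_self v)
    exact Submodule.finiteDimensional_of_le hle⟩
  map_add' v w := Subtype.ext (LinearMap.ext fun x => smul_add (φ x) v w)
  map_smul' c v := Subtype.ext (LinearMap.ext fun x => smul_comm (φ x) c v)

theorem coe_rankOneOp_apply {k V : Type*} [Field k] [AddCommGroup V] [Module k V]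
    (φ : Module.Dual k V) (v x : V) : (rankOneOp φ v : Module.End k V) x = φ x • v :=
  rfl

theorem mul_rankOneOp {k V : Type*} [Field k] [AddCommGroup V] [Module k V]
    (A : finRankOps k V) (φ : Module.Dual k V) (v : V) :
    A * rankOneOp φ v = rankOneOp φ ((A : Module.End k V) v) :=
  Subtype.ext (LinearMap.ext fun x => map_smul (A : Module.End k V) (φ x) v)

/-- Every derivation of the algebra of finite-rank endomorphisms of a nonzero vector space,
with values in all endomorphisms, is given by commutation with some endomorphism `L`. -/
theorem derivation_finRank_eq_commutator {k V : Type*} [Field k] [AddCommGroup V] [Module k V]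
    [Nontrivial V]
    (D : finRankOps k V →ₗ[k] Module.End k V)
    (hD : ∀ A B : finRankOps k V,
      D (A * B) = D A * (B : Module.End k V) + (A : Module.End k V) * D B) :
    ∃ L : Module.End k V,
      ∀ A : finRankOps k V, D A = L * (A : Module.End k V) - (A : Module.End k V) * L := by
  obtain ⟨e, he⟩ := exists_ne (0 : V)
  obtain ⟨φ, hφ⟩ : ∃ φ : Module.Dual k V, φ e = 1 := by
    obtain ⟨f, hf⟩ := not_forall.mp fun h => he ((Module.forall_dual_apply_eq_zero_iff k e).mp h)
    exact ⟨(f e)⁻¹ • f, inv_mul_cancel₀ hf⟩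
  refine ⟨(LinearMap.applyₗ e).comp (D.comp (rankOneOp φ)), fun A => LinearMap.ext fun v => ?_⟩
  have h := LinearMap.congr_fun (hD A (rankOneOp φ v)) e
  rw [mul_rankOneOp] at h
  simp only [LinearMap.add_apply, Module.End.mul_apply, coe_rankOneOp_apply, hφ, one_smul] at h
  simp [h]
end

section
/- Let B be a (possibly noncommutative) ring, A a subring of B, and I a two-sided ideal of A. Assume I has trivial left annihilator in B, i.e., for every b ∈ B, if b * x = 0 for all x ∈ I then b = 0. Let D : A → B be an additive map satisfying D(x * y) = D(x) * y + x * D(y) for all x, y ∈ A, and suppose there exists l ∈ B such that D(x) = l * x − x * l for every x ∈ I. Then D(a) = l * a − a * l for every a ∈ A. -/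
/-- If a derivation `D : A → B` is given by commutation with `l ∈ B` on a two-sided ideal
`I` of `A` which has trivial left annihilator in `B`, then `D` is given by commutation
with `l` on all of `A`. -/
theorem derivation_eq_commutator_of_eq_on_ideal {B : Type*} [Ring B] (A : Subring B)
    (I : AddSubgroup B) (hIA : (I : Set B) ⊆ (A : Set B))
    (hI_left : ∀ a ∈ A, ∀ x ∈ I, a * x ∈ I)
    (hI_right : ∀ a ∈ A, ∀ x ∈ I, x * a ∈ I)
    (hann : ∀ b : B, (∀ x ∈ I, b * x = 0) → b = 0)
    (D : A →+ B)
    (hD : ∀ x y : A, D (x * y) = D x * (y : B) + (x : B) * D y)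
    (l : B)
    (hl : ∀ x : A, (x : B) ∈ I → D x = l * (x : B) - (x : B) * l) :
    ∀ a : A, D a = l * (a : B) - (a : B) * l := by
  intro a
  refine sub_eq_zero.mp (hann _ fun x hx => ?_)
  have hax := hl (a * ⟨x, hIA hx⟩) (hI_left a a.2 x hx)
  rw [hD, hl ⟨x, hIA hx⟩ hx, Subring.coe_mul, ← eq_sub_iff_add_eq] at hax
  rw [sub_mul, hax]
  noncomm_ring
end

section
/- Let k be a field and V₁, V₂ k-vector spaces. Let A₁ ⊆ End_k(V₁) and A₂ ⊆ End_k(V₂) be subalgebras, and let Φ : A₁ → A₂ be a bijective k-linear map with Φ(x ∘ y) = Φ(x) ∘ Φ(y) for all x, y ∈ A₁. Let I be a two-sided ideal of A₁ such that the ranges of the elements of I together span V₁ (the supremum over x ∈ I of the range of x is all of V₁). Suppose G : V₁ → V₂ is a k-linear isomorphism such that Φ(x) = G ∘ x ∘ G⁻¹ for every x ∈ I. Then Φ(a) = G ∘ a ∘ G⁻¹ for every a ∈ A₁. -/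
/-- An algebra isomorphism between subalgebras of endomorphism algebras which is implemented
by conjugation by a linear isomorphism `G` on a two-sided ideal whose elements have ranges
spanning the whole space, is implemented by conjugation by `G` on the whole subalgebra. -/
theorem conj_on_ideal_implies_conj {k V₁ V₂ : Type*} [Field k]
    [AddCommGroup V₁] [Module k V₁] [AddCommGroup V₂] [Module k V₂]
    (A₁ : NonUnitalSubalgebra k (Module.End k V₁))
    (A₂ : NonUnitalSubalgebra k (Module.End k V₂))
    (Φ : A₁ →ₗ[k] A₂) (hΦ : Function.Bijective Φ)
    (hmul : ∀ x y : A₁, Φ (x * y) = Φ x * Φ y)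
    (I : AddSubgroup A₁)
    (hI_left : ∀ a : A₁, ∀ x ∈ I, a * x ∈ I)
    (hI_right : ∀ a : A₁, ∀ x ∈ I, x * a ∈ I)
    (hspan : (⨆ x : I, LinearMap.range ((x : A₁) : Module.End k V₁)) = ⊤)
    (G : V₁ ≃ₗ[k] V₂)
    (hG : ∀ x : A₁, x ∈ I →
      ((Φ x : Module.End k V₂) : V₂ →ₗ[k] V₂)
        = G.toLinearMap ∘ₗ ((x : Module.End k V₁) : V₁ →ₗ[k] V₁) ∘ₗ G.symm.toLinearMap) :
    ∀ a : A₁,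
      ((Φ a : Module.End k V₂) : V₂ →ₗ[k] V₂)
        = G.toLinearMap ∘ₗ ((a : Module.End k V₁) : V₁ →ₗ[k] V₁) ∘ₗ G.symm.toLinearMap := by
  intro a
  have hrange : ∀ x ∈ I, LinearMap.range ((x : A₁) : Module.End k V₁) ≤
      LinearMap.eqLocus ((Φ a : Module.End k V₂) ∘ₗ G.toLinearMap)
        (G.toLinearMap ∘ₗ (a : Module.End k V₁)) := by
    rintro x hx _ ⟨w, rfl⟩
    have hprod : (Φ (a * x) : Module.End k V₂) (G w) =
        (Φ a : Module.End k V₂) ((Φ x : Module.End k V₂) (G w)) := by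
      rw [hmul]
      rfl
    rw [hG _ (hI_left a x hx), hG x hx] at hprod
    simpa using hprod.symm
  have htop : ⊤ ≤ LinearMap.eqLocus ((Φ a : Module.End k V₂) ∘ₗ G.toLinearMap)
      (G.toLinearMap ∘ₗ (a : Module.End k V₁)) :=
    hspan ▸ iSup_le fun x => hrange x x.2
  ext v
  simpa using htop (Submodule.mem_top (x := G.symm v))
end

section
/- Let k be a field and V₁, V₂ nonzero k-vector spaces. Let Φ : F(V₁) → F(V₂) be a bijective k-linear map between the algebras of finite-rank endomorphisms satisfying Φ(A ∘ B) = Φ(A) ∘ Φ(B) for all A, B ∈ F(V₁). Then there exists a k-linear isomorphism G : V₁ → V₂ such that Φ(A) = G ∘ A ∘ G⁻¹ for every A ∈ F(V₁). Moreover G is unique up to a nonzero scalar: if G' : V₁ → V₂ is another k-linear isomorphism with Φ(A) = G' ∘ A ∘ G'⁻¹ for all A ∈ F(V₁), then there is a nonzero c ∈ k with G' = c • G. -/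
namespace finRankOps

variable {k V V₁ V₂ : Type*} [Field k] [AddCommGroup V] [Module k V]
  [AddCommGroup V₁] [Module k V₁] [AddCommGroup V₂] [Module k V₂]

theorem smulRight_mem (f : Module.Dual k V) (v : V) : f.smulRight v ∈ finRankOps k V := by
  have hle : LinearMap.range (f.smulRight v) ≤ Submodule.span k {v} := by
    rintro _ ⟨x, rfl⟩
    exact Submodule.smul_mem _ _ (Submodule.mem_span_singleton_self v)
  exact Submodule.finiteDimensional_of_le hle

/-- The finite-rank operator `x ↦ f x • v`, as a linear function of `v`. -/
def rankOne (f : Module.Dual k V) : V →ₗ[k] finRankOps k V where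
  toFun v := ⟨f.smulRight v, smulRight_mem f v⟩
  map_add' v w := Subtype.ext (LinearMap.ext fun x => smul_add (f x) v w)
  map_smul' c v := Subtype.ext (LinearMap.ext fun x => smul_comm (f x) c v)

theorem rankOne_apply (f : Module.Dual k V) (v x : V) :
    (rankOne f v : Module.End k V) x = f x • v := rfl

theorem mul_rankOne (A : finRankOps k V) (f : Module.Dual k V) (v : V) :
    A * rankOne f v = rankOne f ((A : Module.End k V) v) :=
  Subtype.ext (LinearMap.ext fun x => map_smul (A : Module.End k V) (f x) v)

/-- Every isomorphism of algebras of finite-rank operators has an invertible intertwiner. -/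
theorem exists_intertwining_equiv [Nontrivial V₁]
    (Φ : finRankOps k V₁ →ₗ[k] finRankOps k V₂) (hΦ : Function.Bijective Φ)
    (hmul : ∀ A B : finRankOps k V₁, Φ (A * B) = Φ A * Φ B) :
    ∃ G : V₁ ≃ₗ[k] V₂, ∀ (A : finRankOps k V₁) (v : V₁),
      (Φ A : Module.End k V₂) (G v) = G ((A : Module.End k V₁) v) := by
  obtain ⟨v₀, hv₀⟩ := exists_ne (0 : V₁)
  obtain ⟨f₀, hf₀⟩ := Module.Projective.exists_dual_eq_one k hv₀
  have hne : (Φ (rankOne f₀ v₀) : Module.End k V₂) ≠ 0 := by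
    intro h
    have h0 : rankOne f₀ v₀ = 0 := hΦ.1 ((Subtype.ext h).trans (map_zero Φ).symm)
    have h1 : (rankOne f₀ v₀ : Module.End k V₁) v₀ = 0 := by rw [h0]; rfl
    rw [rankOne_apply, hf₀, one_smul] at h1
    exact hv₀ h1
  obtain ⟨w, hw⟩ : ∃ w, (Φ (rankOne f₀ v₀) : Module.End k V₂) w ≠ 0 := by
    by_contra! h
    exact hne (LinearMap.ext h)
  let T : V₁ →ₗ[k] V₂ :=
    { toFun := fun v => (Φ (rankOne f₀ v) : Module.End k V₂) w
      map_add' := fun x y => by rw [map_add, map_add]; rfl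
      map_smul' := fun c x => by rw [map_smul, map_smul]; rfl }
  have hT : ∀ (A : finRankOps k V₁) (v : V₁),
      (Φ A : Module.End k V₂) (T v) = T ((A : Module.End k V₁) v) := by
    intro A v
    change ((Φ A * Φ (rankOne f₀ v) : finRankOps k V₂) : Module.End k V₂) w = _
    rw [← hmul, mul_rankOne]
    rfl
  have hT₀ : T v₀ ≠ 0 := hw
  have hinj : Function.Injective T := by
    rw [injective_iff_map_eq_zero]
    intro v hv
    by_contra hv'
    obtain ⟨f, hf⟩ := Module.Projective.exists_dual_eq_one k hv'
    have h := hT (rankOne f v₀) v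
    rw [hv, map_zero, rankOne_apply, hf, one_smul] at h
    exact hT₀ h.symm
  have hsurj : Function.Surjective T := by
    intro u
    obtain ⟨g, hg⟩ := Module.Projective.exists_dual_eq_one k hT₀
    obtain ⟨A, hA⟩ := hΦ.2 (rankOne g u)
    refine ⟨(A : Module.End k V₁) v₀, ?_⟩
    rw [← hT, hA, rankOne_apply, hg, one_smul]
  exact ⟨LinearEquiv.ofBijective T ⟨hinj, hsurj⟩, hT⟩

theorem eq_conj_iff (G : V₁ ≃ₗ[k] V₂) (A : Module.End k V₁) (B : Module.End k V₂) :
    B = G.toLinearMap ∘ₗ A ∘ₗ G.symm.toLinearMap ↔ ∀ v, B (G v) = G (A v) := by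
  refine ⟨fun h v => by simp [h], fun h => LinearMap.ext fun w => ?_⟩
  simpa using h (G.symm w)

/-- Two intertwiners of the same map of finite-rank operators are proportional. -/
theorem intertwining_equiv_unique [Nontrivial V₁] {Φ : finRankOps k V₁ → finRankOps k V₂}
    {G G' : V₁ ≃ₗ[k] V₂}
    (hG : ∀ (A : finRankOps k V₁) (v : V₁),
      (Φ A : Module.End k V₂) (G v) = G ((A : Module.End k V₁) v))
    (hG' : ∀ (A : finRankOps k V₁) (v : V₁),
      (Φ A : Module.End k V₂) (G' v) = G' ((A : Module.End k V₁) v)) :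
    ∃ c : k, c ≠ 0 ∧ (G' : V₁ →ₗ[k] V₂) = c • (G : V₁ →ₗ[k] V₂) := by
  obtain ⟨v₀, hv₀⟩ := exists_ne (0 : V₁)
  obtain ⟨f₀, hf₀⟩ := Module.Projective.exists_dual_eq_one k hv₀
  have key : ∀ v, G' v = f₀ (G.symm (G' v₀)) • G v := by
    intro v
    have h := hG (rankOne f₀ v) (G.symm (G' v₀))
    rw [G.apply_symm_apply, hG', rankOne_apply, rankOne_apply, hf₀, one_smul, map_smul] at h
    exact h
  refine ⟨f₀ (G.symm (G' v₀)), fun hc => hv₀ ?_, LinearMap.ext key⟩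
  have h := key v₀
  rwa [hc, zero_smul, G'.map_eq_zero_iff] at h

end finRankOps

/-- Eidelheit-type theorem: every algebra isomorphism between the algebras of finite-rank
endomorphisms of nonzero vector spaces is spatial, implemented by conjugation by a linear
isomorphism `G` which is unique up to a nonzero scalar multiple. -/
theorem finRank_algIso_spatial {k V₁ V₂ : Type*} [Field k]
    [AddCommGroup V₁] [Module k V₁] [AddCommGroup V₂] [Module k V₂]
    [Nontrivial V₁] [Nontrivial V₂]
    (Φ : finRankOps k V₁ →ₗ[k] finRankOps k V₂) (hΦ : Function.Bijective Φ)
    (hmul : ∀ A B : finRankOps k V₁, Φ (A * B) = Φ A * Φ B) :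
    ∃ G : V₁ ≃ₗ[k] V₂,
      (∀ A : finRankOps k V₁,
        ((Φ A : Module.End k V₂) : V₂ →ₗ[k] V₂)
          = G.toLinearMap ∘ₗ ((A : Module.End k V₁) : V₁ →ₗ[k] V₁) ∘ₗ G.symm.toLinearMap) ∧
      ∀ G' : V₁ ≃ₗ[k] V₂,
        (∀ A : finRankOps k V₁,
          ((Φ A : Module.End k V₂) : V₂ →ₗ[k] V₂)
            = G'.toLinearMap ∘ₗ ((A : Module.End k V₁) : V₁ →ₗ[k] V₁) ∘ₗ G'.symm.toLinearMap) →
        ∃ c : k, c ≠ 0 ∧ (G' : V₁ →ₗ[k] V₂) = c • (G : V₁ →ₗ[k] V₂) := by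
  obtain ⟨G, hG⟩ := finRankOps.exists_intertwining_equiv Φ hΦ hmul
  refine ⟨G, fun A => (finRankOps.eq_conj_iff G _ _).2 (hG A), fun G' hG' => ?_⟩
  exact finRankOps.intertwining_equiv_unique hG
    fun A => (finRankOps.eq_conj_iff G' _ _).1 (hG' A)
end

section
/- Let X be a set with a cover by subsets {U_i}_{i ∈ ι}, let G be a group, A an abelian group (written additively), φ : G → A a group homomorphism, and σ : A → G any map with φ(σ(a)) = a for all a ∈ A. Suppose g_{ij} : U_i ∩ U_j → G satisfy the cocycle condition g_{ij}(x) · g_{jk}(x) = g_{ik}(x) for all x ∈ U_i ∩ U_j ∩ U_k, and suppose s_i : U_i → A are maps with φ(g_{ij}(x)) = s_i(x) − s_j(x) for all x ∈ U_i ∩ U_j. Define g'_{ij}(x) = σ(s_i(x))⁻¹ · g_{ij}(x) · σ(s_j(x)). Then g'_{ij} again satisfies the cocycle condition g'_{ij}(x) · g'_{jk}(x) = g'_{ik}(x) on triple overlaps, takes all its values in the kernel of φ, and is cohomologous to g_{ij} via h_i = σ ∘ s_i, i.e., g'_{ij}(x) = h_i(x)⁻¹ · g_{ij}(x) · h_j(x).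 -/
/-- Reduction of a Čech 1-cocycle to the kernel of a homomorphism `φ : G → A`, given a
splitting `s` of the induced additive cocycle and a section `σ` of `φ`: the modified cocycle
`g'_{ij} = σ(s_i)⁻¹ g_{ij} σ(s_j)` is again a cocycle, takes values in the kernel of `φ`, and
is cohomologous to `g` via `h_i = σ ∘ s_i`. -/
theorem cocycle_reduction_to_kernel {X ι G A : Type*} [Group G] [AddCommGroup A]
    (U : ι → Set X) (hUcover : (⋃ i, U i) = Set.univ)
    (φ : G → A) (hφ : ∀ g h : G, φ (g * h) = φ g + φ h)
    (σ : A → G) (hσ : ∀ a : A, φ (σ a) = a)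
    (g : ι → ι → X → G)
    (hcocycle : ∀ i j l : ι, ∀ x ∈ U i ∩ U j ∩ U l, g i j x * g j l x = g i l x)
    (s : ι → X → A)
    (hs : ∀ i j : ι, ∀ x ∈ U i ∩ U j, φ (g i j x) = s i x - s j x)
    (g' : ι → ι → X → G)
    (hg' : ∀ i j : ι, ∀ x : X, g' i j x = (σ (s i x))⁻¹ * g i j x * σ (s j x)) :
    (∀ i j l : ι, ∀ x ∈ U i ∩ U j ∩ U l, g' i j x * g' j l x = g' i l x) ∧
    (∀ i j : ι, ∀ x ∈ U i ∩ U j, φ (g' i j x) = 0) ∧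
    (∀ i j : ι, ∀ x : X, g' i j x = ((σ ∘ s i) x)⁻¹ * g i j x * ((σ ∘ s j) x)) := by
  refine ⟨fun i j l x hx => ?_, fun i j x hx => ?_, hg'⟩
  · rw [hg', hg', hg', ← hcocycle i j l x hx]
    group
  · have hone : φ 1 = 0 := by simpa using hφ 1 1
    have hinv (a : G) : φ a⁻¹ = -φ a :=
      eq_neg_of_add_eq_zero_left (by rw [← hφ, inv_mul_cancel, hone])
    rw [hg', hφ, hφ, hinv, hσ, hσ, hs i j x hx]
    abel
end
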